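/- arXiv:2412.04926 — 3 statements merged into one kernel-verified Lean document; each statement's English description precedes it below -/
import Mathlib

section
/- For ν > 2, the set A_ν = {t irrational : |t − p/q| ≤ q^{−ν} for infinitely many coprime pairs (p,q)} has Hausdorff dimension 2/ν (Jarník–Besicovitch theorem). -/
open MeasureTheory

/-- The set of `ν`-well-approximable irrationals. -/
def Aset (ν : ℝ) : Set ℝ :=
  {t : ℝ | Irrational t ∧
    {pq : ℤ × ℕ | 0 < pq.2 ∧ IsCoprime pq.1 (pq.2 : ℤ) ∧
      |t - (pq.1 : ℝ) / (pq.2 : ℝ)| ≤ (pq.2 : ℝ) ^ (-ν)}.Infinite}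

open Set Filter Topology
open scoped ENNReal NNReal

/-- Hausdorff–Cantelli lemma. -/
theorem hausdorffMeasure_limsup_eq_zero {X ι : Type*} [EMetricSpace X] [MeasurableSpace X]
    [BorelSpace X] [Countable ι] {s : ℝ} (hs : 0 < s) (U : ι → Set X)
    (hU : ∑' i, Metric.ediam (U i) ^ s ≠ ∞) :
    μH[s] {x | {i | x ∈ U i}.Infinite} = 0 := by
  have htail := ENNReal.tendsto_tsum_compl_atTop_zero hU
  have hle := Measure.hausdorffMeasure_le_liminf_tsum s {x | {i | x ∈ U i}.Infinite}
    (l := (atTop : Filter (Finset ι)))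
    (fun F => (∑' i : {i // i ∉ F}, Metric.ediam (U i) ^ s) ^ s⁻¹)
    (by simpa [hs] using htail.ennrpow_const s⁻¹)
    (fun F (i : {i // i ∉ F}) => U i)
    (Eventually.of_forall fun F i => by
      rw [ENNReal.le_rpow_inv_iff hs]
      exact ENNReal.le_tsum (f := fun i : {i // i ∉ F} => Metric.ediam (U i) ^ s) i)
    (Eventually.of_forall fun F x hx => by
      obtain ⟨i, hi, hiF⟩ := Set.Infinite.exists_notMem_finset hx F
      exact mem_iUnion.2 ⟨⟨i, hiF⟩, hi⟩)
  rw [htail.liminf_eq] at hle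
  exact nonpos_iff_eq_zero.1 hle

/-- The pairs `(p, q)` with `|p| ≤ M q` contribute a convergent sum. -/
theorem tsum_ediam_approx_ne_top {ν s : ℝ} (hν : 0 < ν) (hs : 0 < s) (hνs : 2 < ν * s) (M : ℕ) :
    ∑' pq : ℤ × ℕ, Metric.ediam (if |pq.1| ≤ (M * pq.2 : ℤ) then
      Metric.closedBall ((pq.1 : ℝ) / pq.2) ((pq.2 : ℝ) ^ (-ν)) else ∅) ^ s ≠ ∞ := by
  have hbound : ∀ q : ℕ, ∑' p : ℤ, Metric.ediam (if |p| ≤ (M * q : ℤ) then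
      Metric.closedBall ((p : ℝ) / q) ((q : ℝ) ^ (-ν)) else ∅) ^ s
      ≤ ENNReal.ofReal ((2 * M * q + 1) * (2 * (q : ℝ) ^ (-ν)) ^ s) := by
    intro q
    rw [tsum_eq_sum (s := Finset.Icc (-(M * q : ℤ)) (M * q)) (by
      intro p hp
      have : ¬ |p| ≤ (M * q : ℤ) := by
        rw [abs_le]; simpa using hp
      simp [this, hs])]
    calc _ ≤ ∑ p ∈ Finset.Icc (-(M * q : ℤ)) (M * q),
            ENNReal.ofReal ((2 * (q : ℝ) ^ (-ν)) ^ s) := by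
          refine Finset.sum_le_sum fun p hp => ?_
          rw [← ENNReal.ofReal_rpow_of_nonneg (by positivity) hs.le]
          gcongr
          split_ifs
          · rw [Real.closedBall_eq_Icc, Real.ediam_Icc]
            apply ENNReal.ofReal_le_ofReal; linarith
          · simp
      _ = _ := by
          rw [Finset.sum_const, nsmul_eq_mul, ENNReal.ofReal_mul (by positivity)]
          congr 1
          rw [Int.card_Icc, ← ENNReal.ofReal_natCast]
          congr 1
          have : ((M * q + 1 - -(M * q : ℤ)).toNat : ℤ) = 2 * M * q + 1 := by
            have : (0 : ℤ) ≤ M * q := by positivity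
            rw [Int.toNat_of_nonneg (by linarith)]; ring
          exact_mod_cast this
  rw [ENNReal.tsum_prod', ENNReal.tsum_comm]
  refine ne_top_of_le_ne_top ?_ (ENNReal.tsum_le_tsum hbound)
  apply Summable.tsum_ofReal_ne_top
  have hsum : Summable fun q : ℕ => ((2 * M + 1) * 2 ^ s) * (q : ℝ) ^ (1 - ν * s) :=
    (Real.summable_nat_rpow.2 (by linarith)).mul_left _
  refine Summable.of_nonneg_of_le (fun q => by positivity) (fun q => ?_) hsum
  rcases Nat.eq_zero_or_pos q with rfl | hq
  · have : (0 : ℝ) ^ (-ν) = 0 := Real.zero_rpow (by linarith)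
    simp only [Nat.cast_zero, this, mul_zero, Real.zero_rpow hs.ne']
    positivity
  · have hq1 : (1 : ℝ) ≤ q := by exact_mod_cast hq
    have hq0 : (0 : ℝ) < q := by positivity
    rw [Real.mul_rpow (by norm_num) (by positivity), ← Real.rpow_mul hq0.le,
      show (1 : ℝ) - ν * s = 1 + -ν * s by ring, Real.rpow_add hq0, Real.rpow_one]
    have : (2 * M * q + 1 : ℝ) ≤ (2 * M + 1) * q := by nlinarith
    calc _ ≤ ((2 * M + 1) * q : ℝ) * (2 ^ s * (q : ℝ) ^ (-ν * s)) := by gcongr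
      _ = _ := by ring

theorem dimH_Aset_le {ν : ℝ} (hν : 2 < ν) : dimH (Aset ν) ≤ ENNReal.ofReal (2 / ν) := by
  have hν0 : 0 < ν := by linarith
  refine le_of_forall_gt fun c hc => ?_
  obtain ⟨s, hs1, hs2⟩ := ENNReal.lt_iff_exists_nnreal_btwn.1 hc
  refine lt_of_le_of_lt ?_ hs2
  have hs : 2 / ν < s := by
    rwa [ENNReal.ofReal_lt_coe_iff (by positivity)] at hs1
  have hs0 : (0 : ℝ) < s := lt_trans (by positivity) hs
  have hνs : 2 < ν * s := by
    rw [div_lt_iff₀ hν0] at hs; linarith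
  have hsub : Aset ν ⊆ ⋃ M : ℕ, {x : ℝ | {pq : ℤ × ℕ | x ∈ (if |pq.1| ≤ (M * pq.2 : ℤ) then
      Metric.closedBall ((pq.1 : ℝ) / pq.2) ((pq.2 : ℝ) ^ (-ν)) else ∅)}.Infinite} := by
    rintro x ⟨-, hx⟩
    obtain ⟨M, hM⟩ := exists_nat_ge (|x| + 1)
    refine mem_iUnion.2 ⟨M, hx.mono ?_⟩
    rintro ⟨p, q⟩ ⟨hq, -, hpq⟩
    simp only at hq hpq
    have hq1 : (1 : ℝ) ≤ q := by exact_mod_cast hq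
    have h1 : (q : ℝ) ^ (-ν) ≤ 1 := Real.rpow_le_one_of_one_le_of_nonpos hq1 (by linarith)
    have h2 : |(p : ℝ) / q| ≤ M := by
      have := abs_sub_abs_le_abs_sub ((p : ℝ) / q) x
      rw [abs_sub_comm] at this
      linarith
    have h3 : |p| ≤ (M * q : ℤ) := by
      rw [abs_div, abs_of_pos (by positivity : (0 : ℝ) < q), div_le_iff₀ (by positivity)] at h2
      exact_mod_cast h2
    simp only [mem_ofPred_eq, h3, if_true, Metric.mem_closedBall, Real.dist_eq]
    exact hpq
  refine (dimH_mono hsub).trans ?_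
  rw [dimH_iUnion]
  refine iSup_le fun M => dimH_le_of_hausdorffMeasure_ne_top ?_
  rw [hausdorffMeasure_limsup_eq_zero hs0 _ (tsum_ediam_approx_ne_top hν0 hs0 hνs M)]
  simp

/-- A null set for the `s`-dimensional Hausdorff measure on `ℝ` has coverings by closed balls of
positive radius with arbitrarily small `s`-dimensional content. -/
theorem exists_closedBall_cover_of_hausdorffMeasure_eq_zero {s : ℝ} (hs : 0 < s) {B : Set ℝ}
    (hB : μH[s] B = 0) {ε : ℝ≥0∞} (hε : ε ≠ 0) :
    ∃ (x d : ℕ → ℝ), (∀ i, 0 < d i) ∧ B ⊆ ⋃ i, Metric.closedBall (x i) (d i) ∧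
      ∑' i, ENNReal.ofReal (d i ^ s) ≤ ε := by
  have hε2 : ε / 2 ≠ 0 := by simpa using hε
  obtain ⟨δ, hδ0, hδ⟩ := ENNReal.exists_pos_sum_of_countable hε2 ℕ
  rw [Measure.hausdorffMeasure_apply] at hB
  have h1 : (⨅ (t : ℕ → Set ℝ) (_ : B ⊆ ⋃ n, t n) (_ : ∀ n, Metric.ediam (t n) ≤ 1),
      ∑' n, ⨆ _ : (t n).Nonempty, Metric.ediam (t n) ^ s) < ε / 2 := by
    refine lt_of_le_of_lt (le_trans ?_ hB.le) (pos_iff_ne_zero.2 hε2)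
    exact le_iSup₂ (f := fun (r : ℝ≥0∞) (_ : 0 < r) =>
      ⨅ (t : ℕ → Set ℝ) (_ : B ⊆ ⋃ n, t n) (_ : ∀ n, Metric.ediam (t n) ≤ r),
      ∑' n, ⨆ _ : (t n).Nonempty, Metric.ediam (t n) ^ s) 1 one_pos
  simp only [iInf_lt_iff] at h1
  obtain ⟨t, htB, htd, hsum⟩ := h1
  have hx : ∀ i, ∃ x, (t i).Nonempty → x ∈ t i := fun i => by
    by_cases h : (t i).Nonempty
    · exact ⟨h.some, fun _ => h.some_mem⟩
    · exact ⟨0, fun h' => absurd h' h⟩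
  choose x hx using hx
  refine ⟨x, fun i => max (Metric.ediam (t i)).toReal ((δ i : ℝ) ^ s⁻¹), fun i => ?_, ?_, ?_⟩
  · exact lt_max_of_lt_right (Real.rpow_pos_of_pos (by exact_mod_cast hδ0 i) _)
  · intro y hy
    obtain ⟨i, hi⟩ := mem_iUnion.1 (htB hy)
    refine mem_iUnion.2 ⟨i, ?_⟩
    refine Metric.mem_closedBall.2 (le_max_of_le_left ?_)
    rw [dist_edist]
    exact ENNReal.toReal_mono (ne_top_of_le_ne_top ENNReal.one_ne_top (htd i))
      (Metric.edist_le_ediam_of_mem hi (hx i ⟨y, hi⟩))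
  · calc _ ≤ ∑' i, ((⨆ _ : (t i).Nonempty, Metric.ediam (t i) ^ s) + (δ i : ℝ≥0∞)) := by
          refine ENNReal.tsum_le_tsum fun i => ?_
          rw [← ENNReal.ofReal_rpow_of_nonneg (by positivity) hs.le, ENNReal.ofReal_max,
            (ENNReal.monotone_rpow_of_nonneg hs.le).map_max]
          refine max_le (le_add_right ?_) (le_add_left ?_)
          · rw [ENNReal.ofReal_toReal (ne_top_of_le_ne_top ENNReal.one_ne_top (htd i))]
            by_cases h : (t i).Nonempty
            · simp [h]
            · simp [not_nonempty_iff_eq_empty.1 h, hs]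
          · rw [ENNReal.ofReal_rpow_of_nonneg (by positivity) hs.le,
              Real.rpow_inv_rpow (by positivity) hs.ne']
            simp
      _ ≤ ε / 2 + ε / 2 := by
          rw [ENNReal.tsum_add]
          exact add_le_add hsum.le hδ.le
      _ = ε := ENNReal.add_halves ε

theorem volume_iUnion_closedBall_div_le (Q M : ℕ) (hM : 1 ≤ M) {n : ℕ} (hn : 0 < n) :
    volume (⋃ q ∈ Finset.Icc 1 Q, ⋃ p ∈ Finset.Icc (-(M * q : ℤ)) (M * q),
      Metric.closedBall ((p : ℝ) / (q : ℕ)) (1 / (n * q))) ≤ ENNReal.ofReal (Q * (6 * M / n)) := by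
  refine (measure_biUnion_finset_le _ _).trans ?_
  calc _ ≤ ∑ q ∈ Finset.Icc 1 Q, ENNReal.ofReal (6 * M / n) := by
        refine Finset.sum_le_sum fun q hq => ?_
        have hq : 1 ≤ q := (Finset.mem_Icc.1 hq).1
        refine (measure_biUnion_finset_le _ _).trans ?_
        simp only [Real.volume_closedBall]
        rw [Finset.sum_const, nsmul_eq_mul, Int.card_Icc, ← ENNReal.ofReal_natCast,
          ← ENNReal.ofReal_mul (by positivity)]
        apply ENNReal.ofReal_le_ofReal
        have : ((M * q + 1 - -(M * q : ℤ)).toNat : ℤ) = 2 * M * q + 1 := by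
          have : (0 : ℤ) ≤ M * q := by positivity
          rw [Int.toNat_of_nonneg (by linarith)]; ring
        have : ((M * q + 1 - -(M * q : ℤ)).toNat : ℝ) = 2 * M * q + 1 := by exact_mod_cast this
        rw [this]
        have hM1 : (1 : ℝ) ≤ M := by exact_mod_cast hM
        have hq1 : (1 : ℝ) ≤ q := by exact_mod_cast hq
        have hn1 : (0 : ℝ) < n := by exact_mod_cast hn
        have hMq : (1 : ℝ) ≤ M * q := one_le_mul_of_one_le_of_one_le hM1 hq1
        calc _ ≤ (3 * (M * q) : ℝ) * (2 * (1 / (n * q))) := by gcongr; linarith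
          _ = 6 * M / n := by field_simp; ring
    _ = _ := by
        rw [Finset.sum_const, nsmul_eq_mul, Nat.card_Icc, Nat.add_sub_cancel,
          ENNReal.ofReal_mul (by positivity), ENNReal.ofReal_natCast]

/-- Points outside small neighbourhoods of rationals of small denominator have a rational
approximation of large denominator. -/
theorem exists_rat_den_gt_of_notMem {Q M n : ℕ} (hn : 0 < n) {x : ℝ} (hxM : |x| + 1 ≤ M)
    (hx : x ∉ ⋃ q ∈ Finset.Icc 1 Q, ⋃ p ∈ Finset.Icc (-(M * q : ℤ)) (M * q),
      Metric.closedBall ((p : ℝ) / (q : ℕ)) (1 / (n * q))) :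
    ∃ b : ℚ, Q < b.den ∧ b.den ≤ n ∧ |x - b| ≤ 1 / (n * b.den) := by
  obtain ⟨b, hb, hbn⟩ := Real.exists_rat_abs_sub_le_and_den_le x hn
  have hq : (1 : ℝ) ≤ b.den := by exact_mod_cast b.pos
  have hn1 : (1 : ℝ) ≤ n := by exact_mod_cast hn
  have hb' : |x - b| ≤ 1 / (n * b.den) := hb.trans (by gcongr; linarith)
  refine ⟨b, ?_, hbn, hb'⟩
  by_contra! hQ
  apply hx
  have h1 : (1 : ℝ) / (n * b.den) ≤ 1 := by
    rw [div_le_one (by positivity)]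
    exact one_le_mul_of_one_le_of_one_le hn1 hq
  have h2 : |(b : ℝ)| ≤ M := by
    have := abs_sub_abs_le_abs_sub (b : ℝ) x
    rw [abs_sub_comm] at this
    linarith
  have hcast : (b : ℝ) = (b.num : ℝ) / (b.den : ℝ) := Rat.cast_def b
  have h3 : |b.num| ≤ (M * b.den : ℤ) := by
    rw [hcast, abs_div, abs_of_pos (by positivity : (0 : ℝ) < b.den),
      div_le_iff₀ (by positivity)] at h2
    exact_mod_cast h2
  simp only [mem_iUnion]
  refine ⟨b.den, Finset.mem_Icc.2 ⟨b.pos, hQ⟩, b.num, Finset.mem_Icc.2 (abs_le.1 h3), ?_⟩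
  rw [Metric.mem_closedBall, Real.dist_eq, ← hcast]
  exact hb'

/-- A lower bound on the overlap of a weighted family of balls gives a bound on the weights. -/
theorem mul_volume_le_tsum_of_forall_le {γ : ℝ≥0∞} {G : Set ℝ} (W : ℕ → ℝ≥0∞) (x e : ℕ → ℝ)
    (hG : ∀ y ∈ G, γ ≤ ∑' i, (Metric.closedBall (x i) (e i)).indicator (fun _ => W i) y) :
    γ * volume G ≤ ∑' i, W i * ENNReal.ofReal (2 * e i) := by
  have hmeas : ∀ i, Measurable ((Metric.closedBall (x i) (e i)).indicator fun _ => W i) :=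
    fun i => measurable_const.indicator measurableSet_closedBall
  calc γ * volume G = ∫⁻ _ in G, γ := by simp
    _ ≤ ∫⁻ y in G, ∑' i, (Metric.closedBall (x i) (e i)).indicator (fun _ => W i) y :=
        setLIntegral_mono (Measurable.tsum hmeas) hG
    _ ≤ ∫⁻ y, ∑' i, (Metric.closedBall (x i) (e i)).indicator (fun _ => W i) y :=
        setLIntegral_le_lintegral _ _
    _ = ∑' i, W i * ENNReal.ofReal (2 * e i) := by
        rw [lintegral_tsum fun i => (hmeas i).aemeasurable]
        refine tsum_congr fun i => ?_
        rw [lintegral_indicator_const measurableSet_closedBall, Real.volume_closedBall]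

theorem exists_nat_scale {ν s κ : ℝ} (hν : 2 < ν) (hκ0 : 0 < κ) (hκ1 : κ < 1)
    (hκ : ν * s < 1 + κ) {r : ℝ} (hr : 0 < r) (M N : ℕ) :
    ∃ n : ℕ, 0 < n ∧ (N : ℝ) + 1 ≤ (n : ℝ) ^ κ ∧ 2 * (n : ℝ) ^ (-(1 + κ)) ≤ r / 2 ∧
      (n : ℝ) ^ κ * (6 * M / n) ≤ r / 2 ∧
      4 * (n : ℝ) ^ (-(1 + κ)) * (r / 16) ^ s < 3 * r / 8 * ((n : ℝ) ^ (-ν) / 16) ^ s ∧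
      (n : ℝ) ^ (-ν) ≤ 1 / (N + 1) := by
  have hc := tendsto_natCast_atTop_atTop (R := ℝ)
  have neg : ∀ y : ℝ, 0 < y → ∀ C : ℝ, Tendsto (fun n : ℕ => C * (n : ℝ) ^ (-y)) atTop (𝓝 0) :=
    fun y hy C => by simpa using ((tendsto_rpow_neg_atTop hy).comp hc).const_mul C
  have e1 := ((tendsto_rpow_atTop hκ0).comp hc).eventually_ge_atTop ((N : ℝ) + 1)
  have e2 := (neg (1 + κ) (by linarith) 2).eventually_le_const (by positivity : 0 < r / 2)
  have e3 := (neg (1 - κ) (by linarith) (6 * M)).eventually_le_const (by positivity : 0 < r / 2)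
  have e4 := (neg (1 + κ - ν * s) (by linarith) (4 * (r / 16) ^ s)).eventually_lt_const
    (by positivity : 0 < 3 * r / 8 * (1 / 16) ^ s)
  have e5 := (neg ν (by linarith) 1).eventually_le_const (by positivity : (0 : ℝ) < 1 / (N + 1))
  obtain ⟨n, h1, h2, h3, h4, h5, h0⟩ :=
    (e1.and (e2.and (e3.and (e4.and (e5.and (eventually_gt_atTop 0)))))).exists
  have hn : (0 : ℝ) < n := by exact_mod_cast h0
  refine ⟨n, h0, h1, h2, ?_, ?_, by simpa using h5⟩
  · have : (n : ℝ) ^ κ * (6 * M / n) = 6 * M * (n : ℝ) ^ (-(1 - κ)) := by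
      rw [show -(1 - κ) = κ - 1 by ring, Real.rpow_sub hn, Real.rpow_one]
      ring
    rwa [this]
  · have hpos : (0 : ℝ) < (n : ℝ) ^ (-ν * s) := by positivity
    have h4' := mul_lt_mul_of_pos_right h4 hpos
    rw [div_eq_mul_one_div ((n : ℝ) ^ (-ν)), Real.mul_rpow (by positivity) (by positivity),
      ← Real.rpow_mul hn.le]
    have : (n : ℝ) ^ (-(1 + κ)) = (n : ℝ) ^ (-(1 + κ - ν * s)) * (n : ℝ) ^ (-ν * s) := by
      rw [← Real.rpow_add hn]; ring_nf
    rw [this]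
    linarith

/-- The `s`-dimensional content, within a family of balls `closedBall (x i) (d i)`, of those balls
which meet `closedBall a r`. -/
noncomputable def contentMeeting (s : ℝ) (x d : ℕ → ℝ) (a r : ℝ) : ℝ≥0∞ :=
  ∑' i, {i | |x i - a| ≤ d i + r}.indicator (fun i => ENNReal.ofReal (d i ^ s)) i

theorem le_of_contentMeeting_le {s : ℝ} (hs : 0 < s) {x d : ℕ → ℝ} (hd : ∀ i, 0 < d i) {a r ρ : ℝ}
    (hρ : 0 ≤ ρ) (h : contentMeeting s x d a r ≤ ENNReal.ofReal (ρ ^ s)) {i : ℕ}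
    (hi : |x i - a| ≤ d i + r) : d i ≤ ρ := by
  have h1 := (ENNReal.le_tsum i).trans h
  rw [indicator_of_mem (by exact hi), ENNReal.ofReal_le_ofReal_iff (by positivity)] at h1
  exact (Real.rpow_le_rpow_iff (hd i).le hρ hs).1 h1

/-- If `∑ dᵢ ^ s ≤ ρ ^ s` then `∑ dᵢ ≤ ρ`, for `s ≤ 1`. -/
theorem tsum_indicator_le_of_contentMeeting_le {s : ℝ} (hs : 0 < s) (hs1 : s ≤ 1) {x d : ℕ → ℝ}
    (hd : ∀ i, 0 < d i) {a r ρ : ℝ} (hρ : 0 < ρ)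
    (h : contentMeeting s x d a r ≤ ENNReal.ofReal (ρ ^ s)) :
    ∑' i, {i | |x i - a| ≤ d i + r}.indicator (fun i => ENNReal.ofReal (d i)) i
      ≤ ENNReal.ofReal ρ := by
  calc _ ≤ ∑' i, ENNReal.ofReal (ρ ^ (1 - s)) *
        {i | |x i - a| ≤ d i + r}.indicator (fun i => ENNReal.ofReal (d i ^ s)) i := by
        refine ENNReal.tsum_le_tsum fun i => ?_
        by_cases hi : i ∈ {i | |x i - a| ≤ d i + r}
        · rw [indicator_of_mem hi, indicator_of_mem hi, ← ENNReal.ofReal_mul (by positivity)]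
          apply ENNReal.ofReal_le_ofReal
          have h1 : d i ^ (1 - s) ≤ ρ ^ (1 - s) :=
            Real.rpow_le_rpow (hd i).le (le_of_contentMeeting_le hs hd hρ.le h hi) (by linarith)
          have h2 : 0 ≤ d i ^ s := Real.rpow_nonneg (hd i).le _
          calc d i = d i ^ (1 - s) * d i ^ s := by
                rw [← Real.rpow_add (hd i), sub_add_cancel, Real.rpow_one]
            _ ≤ _ := by gcongr
        · simp [indicator_of_notMem hi]
    _ ≤ ENNReal.ofReal (ρ ^ (1 - s)) * ENNReal.ofReal (ρ ^ s) := by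
        rw [ENNReal.tsum_mul_left]
        gcongr
        exact h
    _ = ENNReal.ofReal ρ := by
        rw [← ENNReal.ofReal_mul (by positivity), ← Real.rpow_add hρ, sub_add_cancel, Real.rpow_one]

/-- If every ball `closedBall b ρ` with centre within `h` of `G` has large content of balls meeting
it, then `G` has small volume. -/
theorem volume_le_of_forall_lt_contentMeeting {s : ℝ} (hs : 0 < s) (hs1 : s ≤ 1) {x d : ℕ → ℝ}
    (hd : ∀ i, 0 < d i) {a r σ ρ h : ℝ} (hσ : 0 < σ) {γ : ℝ} (hγ : 0 ≤ γ) (hρh : ρ ≤ h)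
    (hcont : contentMeeting s x d a r ≤ ENNReal.ofReal (σ ^ s)) {G : Set ℝ}
    (hG : ∀ y ∈ G, ∃ b, |y - b| ≤ h ∧ |b - a| + ρ ≤ r ∧
      ENNReal.ofReal γ < contentMeeting s x d b ρ) (hh : 0 ≤ h) :
    ENNReal.ofReal γ * volume G ≤ ENNReal.ofReal (2 * γ * σ + 4 * h * σ ^ s) := by
  set S := {i | |x i - a| ≤ d i + r}
  set W : ℕ → ℝ≥0∞ :=
    S.indicator fun i => min (ENNReal.ofReal (d i ^ s)) (ENNReal.ofReal γ) with hW
  have hmain := mul_volume_le_tsum_of_forall_le (γ := ENNReal.ofReal γ) (G := G) W x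
    (fun i => d i + 2 * h) ?_
  · refine hmain.trans ?_
    calc _ ≤ ∑' i, (ENNReal.ofReal (2 * γ) * S.indicator (fun i => ENNReal.ofReal (d i)) i +
          ENNReal.ofReal (4 * h) * S.indicator (fun i => ENNReal.ofReal (d i ^ s)) i) := by
          refine ENNReal.tsum_le_tsum fun i => ?_
          by_cases hi : i ∈ S
          · simp only [hW, indicator_of_mem hi]
            have hdi := (hd i).le
            rw [show 2 * (d i + 2 * h) = 2 * d i + 4 * h by ring,
              ENNReal.ofReal_add (by positivity) (by positivity), mul_add]
            refine add_le_add ?_ ?_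
            · calc _ ≤ ENNReal.ofReal γ * ENNReal.ofReal (2 * d i) := by
                    gcongr; exact min_le_right _ _
                _ = _ := by
                  rw [← ENNReal.ofReal_mul (by positivity), ← ENNReal.ofReal_mul (by positivity)]
                  congr 1; ring
            · rw [mul_comm]
              gcongr; exact min_le_left _ _
          · simp [hW, indicator_of_notMem hi]
      _ ≤ ENNReal.ofReal (2 * γ) * ENNReal.ofReal σ +
          ENNReal.ofReal (4 * h) * ENNReal.ofReal (σ ^ s) := by
          rw [ENNReal.tsum_add, ENNReal.tsum_mul_left, ENNReal.tsum_mul_left]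
          gcongr
          · exact tsum_indicator_le_of_contentMeeting_le hs hs1 hd hσ hcont
          · exact hcont
      _ = _ := by
          rw [← ENNReal.ofReal_mul (by positivity), ← ENNReal.ofReal_mul (by positivity),
            ← ENNReal.ofReal_add (by positivity) (by positivity)]
  · intro y hy
    obtain ⟨b, hyb, hba, hb⟩ := hG y hy
    have key : ∀ i, |x i - b| ≤ d i + ρ → i ∈ S ∧ y ∈ Metric.closedBall (x i) (d i + 2 * h) := by
      intro i hi
      refine ⟨?_, ?_⟩
      · change |x i - a| ≤ d i + r
        have := abs_sub_le (x i) b a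
        linarith
      · rw [Metric.mem_closedBall, Real.dist_eq]
        have := abs_sub_le y b (x i)
        rw [abs_sub_comm b] at this
        linarith
    by_cases hbig : ∃ i, |x i - b| ≤ d i + ρ ∧ ENNReal.ofReal γ ≤ ENNReal.ofReal (d i ^ s)
    · obtain ⟨i, hi, hγi⟩ := hbig
      refine le_trans ?_ (ENNReal.le_tsum i)
      rw [indicator_of_mem (key i hi).2, hW, indicator_of_mem (key i hi).1, min_eq_right hγi]
    · push Not at hbig
      refine hb.le.trans (ENNReal.tsum_le_tsum fun i => ?_)
      by_cases hi : |x i - b| ≤ d i + ρ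
      · rw [indicator_of_mem (by exact hi), indicator_of_mem (key i hi).2, hW,
          indicator_of_mem (key i hi).1, min_eq_left (hbig i hi).le]
      · rw [indicator_of_notMem (by exact hi)]
        exact zero_le

/-- One step of the nested interval construction. -/
theorem exists_closedBall_contentMeeting_le {ν s : ℝ} (hν : 2 < ν) (hs : 0 < s) (hνs : ν * s < 2)
    {x d : ℕ → ℝ} (hd : ∀ i, 0 < d i) {a r : ℝ} (hr : 0 < r)
    (hcont : contentMeeting s x d a r ≤ ENNReal.ofReal ((r / 16) ^ s)) (N : ℕ) :
    ∃ (b : ℚ) (ρ : ℝ), N < b.den ∧ 0 < ρ ∧ ρ ≤ (b.den : ℝ) ^ (-ν) ∧ ρ ≤ 1 / (N + 1) ∧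
      |(b : ℝ) - a| + ρ ≤ r ∧ contentMeeting s x d b ρ ≤ ENNReal.ofReal ((ρ / 16) ^ s) := by
  have hs1 : s ≤ 1 := by nlinarith
  obtain ⟨κ, hκl, hκ1⟩ := exists_between (max_lt (by linarith) one_pos : max (ν * s - 1) 0 < 1)
  obtain ⟨hκs, hκ0⟩ := max_lt_iff.1 hκl
  obtain ⟨M, hM⟩ := exists_nat_ge (|a| + r + 1)
  have hM1 : 1 ≤ M := by
    have : (1 : ℝ) ≤ M := by linarith [abs_nonneg a]
    exact_mod_cast this
  obtain ⟨n, hn, hN, hh, hbad, hgood, hρN⟩ :=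
    exists_nat_scale (s := s) hν hκ0 hκ1 (by linarith) hr M N
  set h : ℝ := (n : ℝ) ^ (-(1 + κ)) with hh_def
  set ρ : ℝ := (n : ℝ) ^ (-ν) with hρ_def
  have hn1 : (1 : ℝ) ≤ n := by exact_mod_cast hn
  have hn0 : (0 : ℝ) < n := by positivity
  have hh0 : 0 < h := by positivity
  have hρ0 : 0 < ρ := by positivity
  have hρh : ρ ≤ h := Real.rpow_le_rpow_of_exponent_le hn1 (by linarith)
  set Q := ⌊(n : ℝ) ^ κ⌋₊
  set bad : Set ℝ := ⋃ q ∈ Finset.Icc 1 Q, ⋃ p ∈ Finset.Icc (-(M * q : ℤ)) (M * q),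
      Metric.closedBall ((p : ℝ) / (q : ℕ)) (1 / (n * q)) with hbad_def
  have hNQ : N < Q := Nat.lt_of_succ_le (Nat.le_floor (by exact_mod_cast hN))
  have hvol : volume bad ≤ ENNReal.ofReal (r / 2) := by
    refine (volume_iUnion_closedBall_div_le Q M hM1 hn).trans (ENNReal.ofReal_le_ofReal ?_)
    refine le_trans ?_ hbad
    gcongr
    exact Nat.floor_le (by positivity)
  set G := Metric.closedBall a (r / 2) \ bad
  have hG : ENNReal.ofReal (r / 2) ≤ volume G := by
    calc ENNReal.ofReal (r / 2) = ENNReal.ofReal r - ENNReal.ofReal (r / 2) := by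
          rw [← ENNReal.ofReal_sub _ (by positivity)]; congr 1; ring
      _ ≤ volume (Metric.closedBall a (r / 2)) - volume bad := by
          rw [Real.volume_closedBall, mul_div_cancel₀ _ two_ne_zero]
          exact tsub_le_tsub_left hvol _
      _ ≤ volume G := le_measure_sdiff
  by_contra! hcon
  have hle := volume_le_of_forall_lt_contentMeeting hs hs1 hd (by positivity : 0 < r / 16)
    (by positivity : 0 ≤ (ρ / 16) ^ s) hρh hcont (G := G) (fun y hy => by
      have hya : |y - a| ≤ r / 2 := by simpa [Real.dist_eq] using hy.1
      have hyM : |y| + 1 ≤ M := by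
        have := abs_sub_abs_le_abs_sub y a
        linarith
      obtain ⟨b, hQb, hbn, hyb⟩ := exists_rat_den_gt_of_notMem hn hyM hy.2
      have hbn' : (b.den : ℝ) ≤ n := by exact_mod_cast hbn
      have hb0 : (0 : ℝ) < b.den := by exact_mod_cast b.pos
      have hyb' : |y - b| ≤ h := by
        refine hyb.trans ?_
        rw [hh_def, Real.rpow_neg hn0.le, Real.rpow_add hn0, Real.rpow_one, ← one_div]
        gcongr
        exact (Nat.lt_of_floor_lt hQb).le
      have hba : |(b : ℝ) - a| + ρ ≤ r := by
        have := abs_sub_le (b : ℝ) y a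
        rw [abs_sub_comm (b : ℝ) y] at this
        linarith
      exact ⟨b, hyb', hba, hcon b ρ (hNQ.trans hQb) hρ0
        (Real.rpow_le_rpow_of_nonpos hb0 hbn' (by linarith)) hρN hba⟩) hh0.le
  have hfin := (mul_le_mul_right hG (ENNReal.ofReal ((ρ / 16) ^ s))).trans hle
  rw [← ENNReal.ofReal_mul (by positivity), ENNReal.ofReal_le_ofReal_iff (by positivity)] at hfin
  linarith

theorem infinite_of_forall_exists_den_gt {ν t : ℝ}
    (h : ∀ N : ℕ, ∃ b : ℚ, N < b.den ∧ |t - b| ≤ (b.den : ℝ) ^ (-ν)) :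
    {pq : ℤ × ℕ | 0 < pq.2 ∧ IsCoprime pq.1 (pq.2 : ℤ) ∧
      |t - (pq.1 : ℝ) / (pq.2 : ℝ)| ≤ (pq.2 : ℝ) ^ (-ν)}.Infinite := by
  refine Set.Infinite.of_image Prod.snd (Set.infinite_of_not_bddAbove ?_)
  rintro ⟨N, hN⟩
  obtain ⟨b, hNb, hb⟩ := h N
  refine absurd (hN ⟨(b.num, b.den), ⟨b.pos, ?_, ?_⟩, rfl⟩) (not_le.2 hNb)
  · exact Rat.isCoprime_num_den b
  · rwa [← Rat.cast_def]

theorem hausdorffMeasure_approx_ne_zero {ν s : ℝ} (hν : 2 < ν) (hs : 0 < s) (hνs : ν * s < 2) :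
    μH[s] {t : ℝ | {pq : ℤ × ℕ | 0 < pq.2 ∧ IsCoprime pq.1 (pq.2 : ℤ) ∧
      |t - (pq.1 : ℝ) / (pq.2 : ℝ)| ≤ (pq.2 : ℝ) ^ (-ν)}.Infinite} ≠ 0 := by
  intro hzero
  obtain ⟨x, d, hd, hcover, hsum⟩ := exists_closedBall_cover_of_hausdorffMeasure_eq_zero hs hzero
    (ε := ENNReal.ofReal ((1 / 16) ^ s)) (by
      rw [Ne, ENNReal.ofReal_eq_zero, not_le]; positivity)
  let State := {z : ℝ × ℝ // 0 < z.2 ∧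
    contentMeeting s x d z.1 z.2 ≤ ENNReal.ofReal ((z.2 / 16) ^ s)}
  have hstep : ∀ (N : ℕ) (z : State), ∃ z' : State,
      (∃ b : ℚ, z'.1.1 = b ∧ N < b.den ∧ z'.1.2 ≤ (b.den : ℝ) ^ (-ν)) ∧ z'.1.2 ≤ 1 / (N + 1) ∧
      |z'.1.1 - z.1.1| + z'.1.2 ≤ z.1.2 := by
    rintro N ⟨⟨a, r⟩, hr, hc⟩
    obtain ⟨b, ρ, h1, h2, h3, h4, h5, h6⟩ :=
      exists_closedBall_contentMeeting_le hν hs hνs hd hr hc N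
    exact ⟨⟨(b, ρ), h2, h6⟩, ⟨b, rfl, h1, h3⟩, h4, h5⟩
  choose next hnext using hstep
  let z : ℕ → State := fun k => Nat.rec ⟨(0, 1), one_pos, by
    refine le_trans (ENNReal.tsum_le_tsum fun i => ?_) hsum
    exact indicator_le_self _ _ i⟩ (fun N z => next N z) k
  have hz : ∀ k, z (k + 1) = next k (z k) := fun k => rfl
  obtain ⟨t, ht⟩ := IsCompact.nonempty_iInter_of_sequence_nonempty_isCompact_isClosed
    (fun k => Metric.closedBall (z k).1.1 (z k).1.2) (fun k => by
      refine Metric.closedBall_subset_closedBall' ?_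
      rw [hz, Real.dist_eq, add_comm]
      exact (hnext k (z k)).2.2)
    (fun k => Metric.nonempty_closedBall.2 (z k).2.1.le) (isCompact_closedBall _ _)
    (fun k => Metric.isClosed_closedBall)
  have ht : ∀ k, |t - (z k).1.1| ≤ (z k).1.2 := fun k => by
    simpa [Real.dist_eq] using mem_iInter.1 ht k
  have htB := infinite_of_forall_exists_den_gt (ν := ν) (t := t) fun N => by
    obtain ⟨b, hb1, hb2, hb3⟩ := (hnext N (z N)).1
    refine ⟨b, hb2, le_trans ?_ hb3⟩
    rw [← hb1]
    exact ht (N + 1)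
  obtain ⟨i, hi⟩ := mem_iUnion.1 (hcover htB)
  rw [Metric.mem_closedBall, Real.dist_eq, abs_sub_comm] at hi
  obtain ⟨k, hk⟩ := exists_nat_one_div_lt (hd i)
  have h1 : d i ≤ (z (k + 1)).1.2 / 16 :=
    le_of_contentMeeting_le hs hd (by linarith [(z (k + 1)).2.1]) (z (k + 1)).2.2 (by
      have := abs_sub_le (x i) t (z (k + 1)).1.1
      linarith [ht (k + 1)])
  have h2 : (z (k + 1)).1.2 ≤ 1 / (k + 1) := (hnext k (z k)).2.1
  linarith [(z (k + 1)).2.1]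

theorem le_dimH_Aset {ν : ℝ} (hν : 2 < ν) : ENNReal.ofReal (2 / ν) ≤ dimH (Aset ν) := by
  have hν0 : 0 < ν := by linarith
  refine le_of_forall_lt fun c hc => ?_
  obtain ⟨s, hs1, hs2⟩ := ENNReal.lt_iff_exists_nnreal_btwn.1 hc
  refine lt_of_lt_of_le hs1 ?_
  have hs0 : (0 : ℝ) < s := by exact_mod_cast (zero_le.trans_lt hs1 : (0 : ℝ≥0∞) < s)
  have hs : s < 2 / ν := by
    rwa [← ENNReal.ofReal_coe_nnreal, ENNReal.ofReal_lt_ofReal_iff (by positivity)] at hs2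
  have hνs : ν * s < 2 := by
    rw [lt_div_iff₀ hν0] at hs; linarith
  have hle := le_dimH_of_hausdorffMeasure_ne_zero (hausdorffMeasure_approx_ne_zero hν hs0 hνs)
  refine hle.trans ((dimH_mono (t := Aset ν ∪ range ((↑) : ℚ → ℝ)) fun t ht => ?_).trans ?_)
  · by_cases hrat : t ∈ range ((↑) : ℚ → ℝ)
    · exact Or.inr hrat
    · exact Or.inl ⟨hrat, ht⟩
  · simp [dimH_union, (countable_range ((↑) : ℚ → ℝ)).dimH_zero]

/-- Jarník–Besicovitch theorem: for `ν > 2`, `dim_H A_ν = 2/ν`. -/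
theorem jarnik_besicovitch (ν : ℝ) (hν : 2 < ν) :
    dimH (Aset ν) = ENNReal.ofReal (2 / ν) := by
  exact le_antisymm (dimH_Aset_le hν) (le_dimH_Aset hν)
end

section
/- Fix Q ∈ ℕ, Q ≥ 1. The set A_{2,Q} = {t ∈ [0,1] : |t − p/q| ≤ 1/q² for infinitely many coprime pairs (p,q) with q a positive multiple of 4Q} has Lebesgue measure 1. -/
open MeasureTheory

/-- A residue class that is invertible modulo `n` contains a positive representative of the
opposite class which is coprime to a given `m` and bounded by `2nm`. -/
lemma exists_coprime_dvd_add {n m s : ℕ} (hn : 0 < n) (hm : 0 < m) (hs : s.Coprime n) :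
    ∃ y : ℕ, 0 < y ∧ y ≤ 2 * (n * m) ∧ n ∣ y + s ∧ y.Coprime m := by
  have hnm : 0 < n * m := Nat.mul_pos hn hm
  have : NeZero (n * m) := ⟨hnm.ne'⟩
  obtain ⟨w, hw⟩ := ZMod.unitsMap_surjective (Dvd.intro m rfl : n ∣ n * m)
    (-(ZMod.unitOfCoprime s hs))
  have hlt : (w : ZMod (n * m)).val < n * m := ZMod.val_lt _
  refine ⟨(w : ZMod (n * m)).val + n * m, by omega, by omega, ?_, ?_⟩
  · have hw' := congrArg (fun u : (ZMod n)ˣ => (u : ZMod n)) hw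
    simp only [ZMod.unitsMap_val, Units.val_neg, ZMod.coe_unitOfCoprime] at hw'
    rw [← ZMod.natCast_eq_zero_iff]
    push_cast
    rw [ZMod.natCast_val, hw']
    simp
  · have h := ZMod.val_coe_unit_coprime w
    have h2 := Nat.Coprime.coprime_dvd_right (Dvd.intro_left n rfl : m ∣ n * m) h
    simpa using h2

/-- Any coprime pair has a bounded coprime positive linear combination divisible by `N`. -/
lemma exists_coprime_dvd_linear_combination {N q s : ℕ} (hN : 0 < N) (h : q.Coprime s) :
    ∃ a b : ℕ, 0 < a ∧ a ≤ 4 * N ^ 3 ∧ b ≤ 2 * N ∧ a.Coprime b ∧ N ∣ a * q + b * s := by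
  obtain ⟨b, hb0, hb2, k, hbk⟩ : ∃ b, 0 < b ∧ b ≤ 2 * N ∧ ∃ k, b + N * k = q + N := by
    have := Nat.mod_lt q hN
    refine ⟨q % N + N, by omega, by omega, q / N, ?_⟩
    have := Nat.mod_add_div q N
    omega
  have hg : 0 < s.gcd N := Nat.gcd_pos_of_pos_right _ hN
  obtain ⟨s', hs'⟩ := Nat.gcd_dvd_left s N
  obtain ⟨n, hn⟩ := Nat.gcd_dvd_right s N
  have hcop : s'.Coprime n := by
    have := Nat.coprime_div_gcd_div_gcd hg
    rwa [Nat.div_eq_of_eq_mul_right hg hs', Nat.div_eq_of_eq_mul_right hg hn] at this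
  have hgb : (s.gcd N).Coprime b := by
    have hd : (s.gcd N).gcd b ∣ q := by
      have h1 : (s.gcd N).gcd b ∣ N := (Nat.gcd_dvd_left _ _).trans (Nat.gcd_dvd_right _ _)
      have h2 : (s.gcd N).gcd b ∣ q + N :=
        hbk ▸ dvd_add (Nat.gcd_dvd_right _ _) (h1.mul_right k)
      exact (Nat.dvd_add_left h1).1 h2
    have hds : (s.gcd N).gcd b ∣ s := (Nat.gcd_dvd_left _ _).trans (Nat.gcd_dvd_left _ _)
    exact Nat.eq_one_of_dvd_coprimes h hd hds
  generalize s.gcd N = g at hg hs' hn hgb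
  have hn0 : 0 < n := Nat.pos_of_ne_zero (by rintro rfl; omega)
  obtain ⟨y, hy0, hy, ⟨c, hc⟩, hyb⟩ := exists_coprime_dvd_add hn0 hb0 hcop
  refine ⟨g * y, b, Nat.mul_pos hg hy0, ?_, hb2, Nat.Coprime.mul_left hgb hyb, ?_⟩
  · calc g * y ≤ g * (2 * (n * b)) := by gcongr
      _ = 2 * N * b := by rw [hn]; ring
      _ ≤ 2 * N * (2 * N) := by gcongr
      _ = 4 * N ^ 2 := by ring
      _ ≤ 4 * N ^ 3 := Nat.mul_le_mul_left 4 (Nat.pow_le_pow_right hN (by norm_num))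
  · have h1 : g * y + s = N * c := by rw [hs', hn, ← mul_add, hc, mul_assoc]
    have h2 : g * y * q + b * s + N * (g * y + k * s) = N * (c * b) + N * (k * (N * c)) := by
      zify at h1 hbk ⊢
      linear_combination (b + N * k : ℤ) * h1 - (g * y : ℤ) * hbk
    have h3 : N ∣ g * y * q + b * s + N * (g * y + k * s) :=
      h2 ▸ dvd_add (dvd_mul_right _ _) (dvd_mul_right _ _)
    exact (Nat.dvd_add_left (dvd_mul_right _ _)).1 h3

/-- Every reduced fraction `p/q` has a reduced neighbour `p'/q'` with `N ∣ q'`, with `q'`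
comparable to `q` and with cross-determinant bounded in terms of `N`. -/
lemma exists_neighbour_fraction_dvd_den {N : ℕ} (hN : 0 < N) {p : ℤ} {q : ℕ} (hq : 0 < q)
    (h : IsCoprime p (q : ℤ)) :
    ∃ (p' : ℤ) (q' b : ℕ), IsCoprime p' (q' : ℤ) ∧ N ∣ q' ∧ q ≤ q' ∧ q' ≤ 6 * N ^ 3 * q ∧
      b ≤ 6 * N ^ 3 ∧ (q' : ℤ) * p - p' * q = b := by
  obtain ⟨u, v, huv⟩ := h
  have hq' : (0 : ℤ) < q := by exact_mod_cast hq
  obtain ⟨s, hs⟩ := Int.eq_ofNat_of_zero_le (Int.emod_nonneg u hq'.ne')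
  have hsq : s ≤ q := by
    have := Int.emod_lt_of_pos u hq'
    omega
  obtain ⟨r, hr⟩ : ∃ r : ℤ, p * s - q * r = 1 := by
    refine ⟨-v - p * (u / q), ?_⟩
    have := Int.emod_add_mul_ediv u q
    rw [hs] at this
    linear_combination huv + p * this
  have hqs : q.Coprime s := Nat.isCoprime_iff_coprime.1 ⟨-r, p, by linear_combination hr⟩
  obtain ⟨a, b, ha0, ha, hb, hab, hdvd⟩ := exists_coprime_dvd_linear_combination hN hqs
  have hN3 : N ≤ N ^ 3 := Nat.le_self_pow (by norm_num) N
  obtain ⟨x, y, hxy⟩ := Nat.isCoprime_iff_coprime.2 hab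
  refine ⟨a * p + b * r, a * q + b * s, b, ?_, hdvd, ?_, ?_, by omega, ?_⟩
  · refine ⟨x * s - y * q, y * p - x * r, ?_⟩
    push_cast
    linear_combination (x * a + y * b) * hr + hxy
  · nlinarith
  · calc a * q + b * s ≤ 4 * N ^ 3 * q + 2 * N ^ 3 * q := by
          gcongr
          omega
      _ = 6 * N ^ 3 * q := by ring
  · push_cast
    linear_combination (b : ℤ) * hr

/-- Every irrational number has reduced approximations of arbitrarily large denominator divisible
by `N`, with error at most a constant multiple of the inverse square of the denominator. -/
lemma Irrational.exists_approx_dvd_den {t : ℝ} (ht : Irrational t) {N : ℕ} (hN : 0 < N) (n : ℕ) :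
    ∃ (p : ℤ) (q : ℕ), n < q ∧ N ∣ q ∧ IsCoprime p (q : ℤ) ∧
      |t - (p : ℝ) / q| ≤ 2 * (6 * N ^ 3 : ℝ) ^ 2 * ((q : ℝ) ^ 2)⁻¹ := by
  obtain ⟨ε, hε, hε0⟩ := ((Filter.Eventually.filter_mono nhdsWithin_le_nhds
    (ht.eventually_forall_le_dist_cast_rat_of_den_le n)).and
      (self_mem_nhdsWithin (s := Set.Ioi (0 : ℝ)))).exists
  obtain ⟨m, hm⟩ := exists_nat_gt (1 / ε)
  have hε0 : 0 < ε := hε0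
  have hm0 : (0 : ℝ) < m := (by positivity : 0 < 1 / ε).trans hm
  obtain ⟨x, hx, hxm⟩ := Real.exists_rat_abs_sub_le_and_den_le t (Nat.cast_pos.1 hm0)
  have hd : (1 : ℝ) ≤ x.den := by exact_mod_cast x.pos
  have hxn : n < x.den := by
    by_contra! hle
    have h1 : ε ≤ |t - x| := hε x hle
    have h2 : 1 / ((m + 1) * (x.den : ℝ)) < ε := by
      rw [div_lt_iff₀ (by positivity)]
      rw [div_lt_iff₀ hε0] at hm
      nlinarith [mul_pos hε0 hm0, mul_nonneg hε0.le hm0.le]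
    linarith
  have hx2 : |t - x| ≤ ((x.den : ℝ) ^ 2)⁻¹ := by
    refine hx.trans ?_
    rw [one_div]
    have : (x.den : ℝ) ≤ m := by exact_mod_cast hxm
    gcongr
    nlinarith
  obtain ⟨p', q', b, hcop, hdvd, hle, hle', hb, hdet⟩ :=
    exists_neighbour_fraction_dvd_den hN x.pos (Int.isCoprime_iff_nat_coprime.2 x.reduced)
  refine ⟨p', q', by omega, hdvd, hcop, ?_⟩
  have hq : (0 : ℝ) < x.den := by linarith
  have hqq : (x.den : ℝ) ≤ q' := by exact_mod_cast hle
  have hq' : (0 : ℝ) < q' := by linarith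
  have hdist : (x : ℝ) - p' / q' = b / (x.den * q') := by
    rw [Rat.cast_def, div_sub_div _ _ hq.ne' hq'.ne']
    congr 1
    have : ((q' * x.num - p' * x.den : ℤ) : ℝ) = b := by rw [hdet]; simp
    push_cast at this
    linarith
  have hbR : (b : ℝ) ≤ 6 * N ^ 3 := by exact_mod_cast hb
  have hqR : (q' : ℝ) ≤ 6 * N ^ 3 * x.den := by exact_mod_cast hle'
  set D : ℝ := 6 * N ^ 3
  have hD : 0 ≤ D := by positivity
  have e1 : ((x.den : ℝ) ^ 2)⁻¹ ≤ D ^ 2 * ((q' : ℝ) ^ 2)⁻¹ := by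
    rw [← div_eq_mul_inv, inv_eq_one_div, div_le_div_iff₀ (by positivity) (by positivity), one_mul,
      ← mul_pow]
    gcongr
  have e2 : (b : ℝ) / (x.den * q') ≤ D ^ 2 * ((q' : ℝ) ^ 2)⁻¹ := by
    rw [← div_eq_mul_inv, div_le_div_iff₀ (by positivity) (by positivity)]
    calc (b : ℝ) * q' ^ 2 = b * q' * q' := by ring
      _ ≤ D * (D * x.den) * q' := by gcongr
      _ = D ^ 2 * (x.den * q') := by ring
  calc |t - p' / q'| ≤ |t - x| + |(x : ℝ) - p' / q'| := abs_sub_le _ _ _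
    _ = |t - x| + b / (x.den * q') := by
        rw [hdist, abs_of_nonneg (by positivity : (0 : ℝ) ≤ b / (x.den * q'))]
    _ ≤ 2 * D ^ 2 * ((q' : ℝ) ^ 2)⁻¹ := by linarith

/-- For `N > 0`, almost every real number `t` admits infinitely many coprime approximations `p/q`
with `N ∣ q` and `|t - p/q| ≤ q⁻²`. -/
lemma ae_infinite_approx_dvd_den {N : ℕ} (hN : 0 < N) :
    ∀ᵐ t : ℝ, {pq : ℤ × ℕ | 0 < pq.2 ∧ N ∣ pq.2 ∧ IsCoprime pq.1 (pq.2 : ℤ) ∧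
      |t - (pq.1 : ℝ) / (pq.2 : ℝ)| ≤ ((pq.2 : ℝ) ^ 2)⁻¹}.Infinite := by
  let S : ℕ → Set ℝ := fun q => {x | ∃ p : ℤ, IsCoprime p (q : ℤ) ∧ (p : ℝ) / q = x}
  let P : ℕ → Prop := fun q => 0 < q ∧ N ∣ q
  let r : ℕ → ℝ := fun q => ((q : ℝ) ^ 2)⁻¹
  let M : ℝ := 2 * (6 * N ^ 3 : ℝ) ^ 2 + 1
  have hr : Filter.Tendsto r Filter.atTop (nhds 0) :=
    tendsto_inv_atTop_zero.comp
      ((Filter.tendsto_pow_atTop two_ne_zero).comp tendsto_natCast_atTop_atTop)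
  have key := blimsup_thickening_mul_ae_eq volume P S (show 0 < M by positivity) r hr
  have hirr : ∀ᵐ t : ℝ, Irrational t :=
    (Set.countable_range ((↑) : ℚ → ℝ)).ae_notMem volume
  filter_upwards [key.mem_iff, hirr] with t hkey ht
  rw [← Nat.cofinite_eq_atTop, Filter.cofinite.blimsup_set_eq,
    Filter.cofinite.blimsup_set_eq] at hkey
  have hinf : {q : ℕ | P q ∧ t ∈ Metric.thickening (M * r q) (S q)}.Infinite := by
    refine Set.infinite_of_not_bddAbove fun ⟨n, hn⟩ => ?_
    obtain ⟨p, q, hnq, hdvd, hcop, hle⟩ := ht.exists_approx_dvd_den hN n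
    have hq : (0 : ℝ) < q := by exact_mod_cast (Nat.zero_le n).trans_lt hnq
    refine hnq.not_ge (hn ⟨⟨by omega, hdvd⟩, ?_⟩)
    refine Metric.mem_thickening_iff.2 ⟨_, ⟨p, hcop, rfl⟩, ?_⟩
    rw [Real.dist_eq]
    refine hle.trans_lt ?_
    have : 0 < ((q : ℝ) ^ 2)⁻¹ := by positivity
    simp only [M, r]
    linarith
  refine Set.Infinite.of_image Prod.snd ((hkey.1 hinf).mono ?_)
  rintro q ⟨⟨hq, hdvd⟩, hmem⟩
  obtain ⟨_, ⟨p, hcop, rfl⟩, hlt⟩ := Metric.mem_thickening_iff.1 hmem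
  exact ⟨(p, q), ⟨hq, hdvd, hcop, hlt.le⟩, rfl⟩

/-- For `Q ≥ 1`, the set of `t ∈ [0,1]` admitting infinitely many coprime rational
approximations `p/q` with `q` a positive multiple of `4Q` and `|t − p/q| ≤ q^{−2}`
has Lebesgue measure `1` (a consequence of the Duffin–Schaeffer theorem). -/
theorem measure_A_two_Q (Q : ℕ) (hQ : 1 ≤ Q) :
    volume {t : ℝ | t ∈ Set.Icc (0 : ℝ) 1 ∧
      {pq : ℤ × ℕ | 0 < pq.2 ∧ 4 * Q ∣ pq.2 ∧ IsCoprime pq.1 (pq.2 : ℤ) ∧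
        |t - (pq.1 : ℝ) / (pq.2 : ℝ)| ≤ ((pq.2 : ℝ) ^ 2)⁻¹}.Infinite} = 1 := by
  have h := ae_infinite_approx_dvd_den (N := 4 * Q) (by omega)
  have hset := measure_congr (μ := volume) (Filter.eventuallyEq_set.2 (h.mono fun t ht =>
    (and_iff_left ht : _ ↔ t ∈ Set.Icc (0 : ℝ) 1)))
  refine Eq.trans hset ?_
  simp
end

section
/- Fix Q ∈ ℕ, Q ≥ 1, and μ > 2. The set A_{μ,Q} = {t ∈ [0,1] \ ℚ : |t − p/q| ≤ q^{−μ} for infinitely many coprime pairs (p,q) with q ∈ 4Qℕ} satisfies H^{2/μ}(A_{μ,Q}) = ∞; in particular dim_H(A_{μ,Q}) ≥ 2/μ. -/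
open MeasureTheory

/-- The set `A_{μ,Q}` of irrationals in `[0,1]` with infinitely many coprime
approximations `p/q`, `q` a positive multiple of `4Q`, within `q^{−μ}`. -/
def AsetQ (μ : ℝ) (Q : ℕ) : Set ℝ :=
  {t : ℝ | t ∈ Set.Icc (0 : ℝ) 1 ∧ Irrational t ∧
    {pq : ℤ × ℕ | 0 < pq.2 ∧ 4 * Q ∣ pq.2 ∧ IsCoprime pq.1 (pq.2 : ℤ) ∧
      |t - (pq.1 : ℝ) / (pq.2 : ℝ)| ≤ (pq.2 : ℝ) ^ (-μ)}.Infinite}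

/-- If `a` and `b` are coprime, then `a * y + b` is coprime to `N` for some `1 ≤ y ≤ N`. -/
theorem exists_add_mul_isCoprime {N : ℕ} (hN : 0 < N) {a b : ℤ} (h : IsCoprime a b) :
    ∃ y : ℕ, 0 < y ∧ y ≤ N ∧ IsCoprime (a * y + b) (N : ℤ) := by
  classical
  set S := N.primeFactors.filter (fun l : ℕ => ¬ (l : ℤ) ∣ b)
  have hpr : ∀ l ∈ S, l.Prime := fun l hl => Nat.prime_of_mem_primeFactors (Finset.mem_filter.1 hl).1
  refine ⟨∏ l ∈ S, l, Finset.prod_pos fun l hl => (hpr l hl).pos, ?_, ?_⟩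
  · exact Nat.le_of_dvd hN ((Finset.prod_dvd_prod_of_subset _ _ _ (Finset.filter_subset _ _)).trans
      (Nat.prod_primeFactors_dvd N))
  · rw [Int.isCoprime_iff_gcd_eq_one]
    refine Nat.coprime_of_dvd fun l hl h1 h2 => ?_
    have h1' : (l : ℤ) ∣ a * ((∏ l ∈ S, l : ℕ) : ℤ) + b := Int.natCast_dvd.2 h1
    have h2' : l ∣ N := by simpa using h2
    have hlp : Prime (l : ℤ) := Nat.prime_iff_prime_int.1 hl
    by_cases hla : (l : ℤ) ∣ b
    · rcases hlp.dvd_or_dvd ((dvd_add_left hla).1 h1') with h3 | h3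
      · exact hlp.not_isUnit (h.isUnit_of_dvd' h3 hla)
      · obtain ⟨k, hk, hk'⟩ := (hl.prime.dvd_finsetProd_iff _).1 (Int.natCast_dvd_natCast.1 h3)
        have := (Nat.prime_dvd_prime_iff_eq hl (hpr k hk)).1 hk'
        subst this
        exact (Finset.mem_filter.1 hk).2 hla
    · have : l ∈ S := Finset.mem_filter.2 ⟨Nat.mem_primeFactors.2 ⟨hl, h2', hN.ne'⟩, hla⟩
      have h4 : (l : ℤ) ∣ ((∏ l ∈ S, l : ℕ) : ℤ) :=
        Int.natCast_dvd_natCast.2 (Finset.dvd_prod_of_mem _ this)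
      exact hla ((dvd_add_right (h4.mul_left a)).1 h1')

/-- An irrational number has infinitely many rational approximations `p / q` of quality
`O(1 / q ^ 2)` in lowest terms whose denominator is divisible by `N`. -/
theorem Irrational.exists_coprime_dvd_abs_sub_le {t : ℝ} (ht : Irrational t) {N : ℕ} (hN : 0 < N)
    (K : ℕ) : ∃ (p : ℤ) (q : ℕ), K ≤ q ∧ 0 < q ∧ N ∣ q ∧ IsCoprime p (q : ℤ) ∧
      |t - p / q| ≤ 2 * N * (N + 1) ^ 2 / (q : ℝ) ^ 2 := by
  have hτ : Irrational (t * N) := ht.mul_natCast hN.ne'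
  obtain ⟨ε, hε, hε0⟩ := ((hτ.eventually_forall_le_dist_cast_rat_of_den_le K).filter_mono
    (nhdsWithin_le_nhds (s := Set.Ioi 0)) |>.and self_mem_nhdsWithin).exists
  obtain ⟨n, hn⟩ := exists_nat_one_div_lt hε0
  obtain ⟨u, hu, hun⟩ := Real.exists_rat_abs_sub_le_and_den_le (t * N) n.succ_pos
  have hb0 : (0 : ℝ) < u.den := by exact_mod_cast u.den_pos
  have hb1 : (1 : ℝ) ≤ u.den := by exact_mod_cast u.den_pos
  have hbn : (u.den : ℝ) ≤ n + 1 := by exact_mod_cast hun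
  have hKb : K < u.den := by
    by_contra! hc
    have h1 := hε u hc
    rw [Real.dist_eq] at h1
    have h2 : 1 / (((n.succ : ℕ) + 1 : ℝ) * u.den) ≤ 1 / (n + 1 : ℝ) := by
      apply one_div_le_one_div_of_le (by positivity)
      push_cast
      nlinarith
    linarith
  have hu2 : |t * N - u| ≤ 1 / (u.den : ℝ) ^ 2 := by
    refine hu.trans (one_div_le_one_div_of_le (by positivity) ?_)
    push_cast
    nlinarith
  obtain ⟨v, w, hvw⟩ : IsCoprime u.num (u.den : ℤ) :=
    Int.isCoprime_iff_gcd_eq_one.2 (by simpa [Int.gcd] using u.reduced)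
  set a := u.num
  set b := u.den
  have hbz : (0 : ℤ) < b := by exact_mod_cast u.den_pos
  obtain ⟨b', hb'⟩ : ∃ b' : ℕ, (b' : ℤ) = v % b :=
    ⟨(v % b).toNat, Int.toNat_of_nonneg (Int.emod_nonneg _ hbz.ne')⟩
  have hb'b : (b' : ℤ) < b := hb' ▸ Int.emod_lt_of_pos _ hbz
  set a' : ℤ := -(w + a * (v / b)) with ha'
  have hdet : a * b' - a' * b = 1 := by
    have := Int.emod_add_mul_ediv v b
    rw [hb', ha']
    linear_combination hvw + a * this
  obtain ⟨y, hy0, hyN, hy⟩ := exists_add_mul_isCoprime hN (a := a) (b := a')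
    ⟨b', -b, by linear_combination hdet⟩
  set m : ℕ := b * y + b' with hm
  have hbm : b ≤ m := by nlinarith
  have hmb : m ≤ (N + 1) * b := by
    have : b' < b := by exact_mod_cast hb'b
    nlinarith
  have hm0 : 0 < m := u.den_pos.trans_le hbm
  refine ⟨a * y + a', N * m, ?_, by positivity, dvd_mul_right _ _, ?_, ?_⟩
  · nlinarith
  · push_cast
    refine hy.mul_right ⟨-b, a, ?_⟩
    rw [hm]
    push_cast
    linear_combination hdet
  · have hm0' : (0 : ℝ) < m := by exact_mod_cast hm0
    have hN0 : (0 : ℝ) < N := by exact_mod_cast hN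
    have hmb' : (m : ℝ) ≤ (N + 1) * b := by exact_mod_cast hmb
    have hdet' : (a : ℝ) * m - (a * y + a') * b = 1 := by
      have : a * (m : ℤ) - (a * y + a') * b = 1 := by
        rw [hm]; push_cast; linear_combination hdet
      exact_mod_cast this
    have hab : (u : ℝ) = a / b := Rat.cast_def u
    have h1 : (a : ℝ) / b - (a * y + a') / m = 1 / (b * m) := by
      field_simp
      linear_combination hdet'
    have h2 : |t * N - (a * y + a') / m| ≤ 1 / (b : ℝ) ^ 2 + 1 / (b * m) := by
      have : t * N - (a * y + a') / m = (t * N - u) + 1 / (b * m) := by rw [← h1, hab]; ring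
      rw [this]
      refine (abs_add_le _ _).trans (add_le_add hu2 (le_of_eq (abs_of_pos (by positivity))))
    have h3 : 1 / (b : ℝ) ≤ (N + 1) / m := by
      rw [div_le_div_iff₀ hb0 hm0']; linarith
    have h4 : 1 / (b : ℝ) ^ 2 + 1 / (b * m) ≤ 2 * ((N + 1) / m) ^ 2 := by
      have e1 : 1 / (b : ℝ) ^ 2 = (1 / b) ^ 2 := by rw [div_pow, one_pow]
      have e2 : 1 / ((b : ℝ) * m) = (1 / b) * (1 / m) := by rw [div_mul_div_comm, one_mul]
      have h5 : 1 / (m : ℝ) ≤ (N + 1) / m := by gcongr; linarith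
      have h6 : 0 < 1 / (b : ℝ) := by positivity
      have h7 : 0 < 1 / (m : ℝ) := by positivity
      rw [e1, e2]
      nlinarith
    have h8 : t - ((a * y + a' : ℤ) : ℝ) / ((N * m : ℕ) : ℝ)
        = (t * N - (a * y + a') / m) / N := by
      push_cast
      field_simp
    rw [h8, abs_div, abs_of_pos hN0, div_le_iff₀ hN0]
    refine (h2.trans h4).trans (le_of_eq ?_)
    push_cast
    field_simp

section MassTransference

open Filter Topology Metric
open scoped ENNReal NNReal

theorem Real.min_le_rpow_mul_rpow {r c s : ℝ} (hr : 0 < r) (hc : 0 ≤ c) (hs0 : 0 < s)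
    (hs1 : s < 1) : min r c ≤ r ^ (1 - s) * c ^ s := by
  have hm : 0 ≤ min r c := le_min hr.le hc
  calc min r c = min r c ^ (1 - s) * min r c ^ s := by
        rw [← Real.rpow_add_of_nonneg hm (by linarith) hs0.le]; simp
    _ ≤ r ^ (1 - s) * c ^ s := by
        exact mul_le_mul (Real.rpow_le_rpow hm (min_le_left _ _) (by linarith))
          (Real.rpow_le_rpow hm (min_le_right _ _) hs0.le) (by positivity) (by positivity)

/-- If `∑ c i ^ s < ∞`, then almost every point `t` outside the balls `closedBall (y i) (c i)` has
the property that these balls do not cover any small ball of radius `r` whose centre lies within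
`O(r ^ s)` of `t`. -/
theorem ae_eventually_volume_ball_diff_ne_zero {s K : ℝ} (hs0 : 0 < s) (hs1 : s < 1) (hK : 1 ≤ K)
    (y : ℕ → ℝ) (c : ℕ → ℝ≥0) (hc1 : ∀ i, c i ≤ 1) (hc : ∑' i, (c i : ℝ≥0∞) ^ s ≠ ∞) :
    ∀ᵐ t : ℝ, t ∉ ⋃ i, closedBall (y i) (c i) → ∀ᶠ r in 𝓝[>] (0 : ℝ), ∀ x, |t - x| ≤ K * r ^ s →
      volume (ball x r \ ⋃ i, closedBall (y i) (c i)) ≠ 0 := by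
  set W : Set ℝ := ⋃ i, closedBall (y i) (c i) with hW
  set ν : Measure ℝ := Measure.sum fun i => (c i : ℝ≥0∞) ^ s • Measure.dirac (y i) with hν
  have hν_apply : ∀ S : Set ℝ, MeasurableSet S →
      ν S = ∑' i, (c i : ℝ≥0∞) ^ s * S.indicator 1 (y i) := fun S hS => by
    rw [hν, Measure.sum_apply _ hS]
    simp [Measure.dirac_apply' _ hS]
  have : IsFiniteMeasure ν := ⟨by
    rw [hν_apply _ MeasurableSet.univ]
    simpa using hc.lt_top⟩
  have hsing : ν ⟂ₘ volume := by
    refine Measure.MutuallySingular.symm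
      ⟨Set.range y, (Set.countable_range y).measurableSet, (Set.countable_range y).measure_zero _, ?_⟩
    rw [hν_apply _ (Set.countable_range y).measurableSet.compl]
    simp
  have hsum : ∑' i, volume (closedBall (y i) (3 * c i)) ≠ ∞ := by
    have hle : ∀ i, volume (closedBall (y i) (3 * c i)) ≤ 6 * (c i : ℝ≥0∞) ^ s := fun i => by
      have h1 : (c i : ℝ≥0∞) ≤ (c i : ℝ≥0∞) ^ s := by
        have := ENNReal.rpow_le_rpow_of_exponent_ge (x := (c i : ℝ≥0∞))
          (by exact_mod_cast hc1 i) hs1.le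
        simpa using this
      have h2 : volume (closedBall (y i) (3 * c i)) = 6 * (c i : ℝ≥0∞) := by
        rw [Real.volume_closedBall, ← mul_assoc, ENNReal.ofReal_mul (by norm_num),
          ENNReal.ofReal_coe_nnreal]
        norm_num
      rw [h2]
      gcongr
    refine ne_top_of_le_ne_top ?_ (ENNReal.tsum_le_tsum hle)
    rw [ENNReal.tsum_mul_left]
    exact ENNReal.mul_ne_top (by norm_num) hc
  filter_upwards [ae_eventually_notMem hsum, Besicovitch.ae_tendsto_rnDeriv ν volume,
    hsing.rnDeriv_ae_eq_zero] with t ht1 ht2 ht3 htW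
  rw [ht3, Pi.zero_apply] at ht2
  obtain ⟨i0, hi0⟩ := eventually_atTop.1 ht1
  have hclosed : IsClosed (⋃ i ∈ Finset.range i0, closedBall (y i) (c i : ℝ)) :=
    isClosed_biUnion_finset fun i _ => isClosed_closedBall
  have htU : t ∈ (⋃ i ∈ Finset.range i0, closedBall (y i) (c i : ℝ))ᶜ := fun h => by
    simp only [Set.mem_iUnion] at h
    obtain ⟨i, -, hi⟩ := h
    exact htW (Set.mem_iUnion.2 ⟨i, hi⟩)
  obtain ⟨η, hη, hball⟩ := Metric.isOpen_iff.1 hclosed.isOpen_compl t htU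
  have hlim0 : Tendsto (fun r : ℝ => r ^ s) (𝓝[>] 0) (𝓝 0) := by
    have := (Real.continuousAt_rpow_const 0 s (Or.inr hs0.le)).tendsto
    rw [Real.zero_rpow hs0.ne'] at this
    exact this.mono_left nhdsWithin_le_nhds
  have hlim : Tendsto (fun r : ℝ => 3 * K * r ^ s) (𝓝[>] 0) (𝓝[>] 0) := by
    refine tendsto_nhdsWithin_iff.2 ⟨by simpa using hlim0.const_mul (3 * K), ?_⟩
    filter_upwards [self_mem_nhdsWithin] with r (hr : 0 < r)
    exact Set.mem_Ioi.2 (by positivity)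
  have hθ : (0 : ℝ≥0∞) < ENNReal.ofReal (1 / (6 * K)) := ENNReal.ofReal_pos.2 (by positivity)
  filter_upwards [hlim (ht2 (gt_mem_nhds hθ)), self_mem_nhdsWithin,
    hlim (Ioo_mem_nhdsGT hη), Ioo_mem_nhdsGT one_pos] with r hr1 (hr0 : 0 < r) hr2 hr3 x hx hzero
  have hr2 : 3 * K * r ^ s < η := hr2.2
  have hrs : 0 < r ^ s := by positivity
  have hr1 : ν (closedBall t (3 * K * r ^ s)) < ENNReal.ofReal (r ^ s) := by
    have hr1' : ν (closedBall t (3 * K * r ^ s)) / volume (closedBall t (3 * K * r ^ s))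
      < ENNReal.ofReal (1 / (6 * K)) := hr1
    rw [Real.volume_closedBall] at hr1'
    have := (ENNReal.div_lt_iff (Or.inl (ENNReal.ofReal_pos.2 (by positivity)).ne')
      (Or.inl ENNReal.ofReal_ne_top)).1 hr1'
    rw [← ENNReal.ofReal_mul (by positivity)] at this
    convert this using 2
    field_simp
    norm_num
  have hrle : r ≤ K * r ^ s := by
    have : r ≤ r ^ s := by
      simpa using Real.rpow_le_rpow_of_exponent_ge hr0 hr3.2.le hs1.le
    nlinarith
  have hterm : ∀ i, volume (ball x r ∩ closedBall (y i) (c i)) ≤ ENNReal.ofReal (2 * r ^ (1 - s)) *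
      ((c i : ℝ≥0∞) ^ s * (closedBall t (3 * K * r ^ s)).indicator 1 (y i)) := fun i => by
    rcases (ball x r ∩ closedBall (y i) (c i)).eq_empty_or_nonempty with he | ⟨z, hz1, hz2⟩
    · simp [he]
    rw [mem_ball, Real.dist_eq] at hz1
    have hz2' := hz2
    rw [mem_closedBall, Real.dist_eq] at hz2
    rw [abs_lt] at hz1
    rw [abs_le] at hz2 hx
    have hi : i0 ≤ i := by
      by_contra! hlt
      have hz : z ∈ ball t η := by
        rw [mem_ball, Real.dist_eq, abs_lt]
        constructor <;> nlinarith
      exact hball hz (Set.mem_biUnion (Finset.mem_coe.2 (Finset.mem_range.2 hlt)) hz2')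
    have h3 := hi0 i hi
    rw [mem_closedBall, Real.dist_eq, not_le, lt_abs] at h3
    have hcK : (c i : ℝ) < K * r ^ s := by rcases h3 with h3 | h3 <;> linarith
    have hy : y i ∈ closedBall t (3 * K * r ^ s) := by
      rw [mem_closedBall, Real.dist_eq, abs_le]
      constructor <;> linarith
    rw [Set.indicator_of_mem hy, Pi.one_apply, mul_one, ← ENNReal.ofReal_coe_nnreal,
      ENNReal.ofReal_rpow_of_nonneg (c i).coe_nonneg hs0.le, ← ENNReal.ofReal_mul (by positivity)]
    calc volume (ball x r ∩ closedBall (y i) (c i))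
        ≤ min (volume (ball x r)) (volume (closedBall (y i) (c i : ℝ))) :=
          le_min (measure_mono Set.inter_subset_left) (measure_mono Set.inter_subset_right)
      _ = ENNReal.ofReal (2 * min r (c i)) := by
          rw [Real.volume_ball, Real.volume_closedBall, mul_min_of_nonneg _ _ zero_le_two,
            ENNReal.ofReal_min]
      _ ≤ _ := by
          refine ENNReal.ofReal_le_ofReal ?_
          rw [mul_assoc]
          gcongr
          exact Real.min_le_rpow_mul_rpow hr0 (c i).2 hs0 hs1
  have hle : ENNReal.ofReal (2 * r) ≤ ENNReal.ofReal (2 * r ^ (1 - s)) *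
      ν (closedBall t (3 * K * r ^ s)) :=
    calc ENNReal.ofReal (2 * r) = volume (ball x r) := (Real.volume_ball x r).symm
      _ ≤ volume (ball x r ∩ W) + volume (ball x r \ W) := measure_le_inter_add_sdiff _ _ _
      _ = volume (⋃ i, ball x r ∩ closedBall (y i) (c i)) := by
          rw [hzero, add_zero, hW, Set.inter_iUnion]
      _ ≤ ∑' i, volume (ball x r ∩ closedBall (y i) (c i)) := measure_iUnion_le _
      _ ≤ _ := ENNReal.tsum_le_tsum hterm
      _ = _ := by rw [ENNReal.tsum_mul_left, hν_apply _ measurableSet_closedBall]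
  refine absurd hle (not_le.2 ?_)
  calc _ < ENNReal.ofReal (2 * r ^ (1 - s)) * ENNReal.ofReal (r ^ s) :=
        ENNReal.mul_lt_mul_right (ENNReal.ofReal_pos.2 (by positivity)).ne'
          ENNReal.ofReal_ne_top hr1
    _ = ENNReal.ofReal (2 * r) := by
        rw [← ENNReal.ofReal_mul (by positivity), mul_assoc, ← Real.rpow_add hr0]
        simp

section LimsupBalls

variable {ι : Type*} {x r : ι → ℝ} {s K : ℝ}

/-- Balls with `s`-summable radii which do not cover almost all of `ball a R` fail to cover the
limsup set of the balls `closedBall (x i) (r i)` in `closedBall a R`, provided the enlarged balls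
`closedBall (x i) (K * r i ^ s)` have a limsup set of full measure. -/
theorem exists_mem_limsup_closedBall_notMem (hr : ∀ i, 0 < r i) (hs0 : 0 < s) (hs1 : s < 1)
    (hK : 1 ≤ K) (h : ∀ᵐ t : ℝ, ∀ ε > 0, ∃ i, r i < ε ∧ |t - x i| ≤ K * r i ^ s)
    (y : ℕ → ℝ) (c : ℕ → ℝ≥0) (hc1 : ∀ i, c i ≤ 1) (hc : ∑' i, (c i : ℝ≥0∞) ^ s ≠ ∞)
    {a R : ℝ} (ha : volume (ball a R \ ⋃ i, closedBall (y i) (c i)) ≠ 0) :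
    ∃ t ∈ closedBall a R, (∀ ε > 0, ∃ i, r i < ε ∧ |t - x i| ≤ r i) ∧
      t ∉ ⋃ i, closedBall (y i) (c i) := by
  set W : Set ℝ := ⋃ i, closedBall (y i) (c i) with hW
  have hae := ae_eventually_volume_ball_diff_ne_zero hs0 hs1 hK y c hc1 hc
  have step : ∀ (b : {b : ℝ × ℝ // volume (ball b.1 b.2 \ W) ≠ 0}) (k : ℕ),
      ∃ b' : {b : ℝ × ℝ // volume (ball b.1 b.2 \ W) ≠ 0},
        (∃ i, b'.1 = (x i, r i) ∧ r i < 1 / (k + 1)) ∧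
        closedBall b'.1.1 b'.1.2 ⊆ closedBall b.1.1 b.1.2 ∧
        ∀ j < k, Disjoint (closedBall b'.1.1 b'.1.2) (closedBall (y j) (c j)) := by
    rintro ⟨⟨u, v⟩, hb⟩ k
    obtain ⟨t, ⟨htb, htW⟩, hgood, hlim⟩ :=
      Measure.exists_mem_of_measure_ne_zero_of_ae hb (ae_restrict_of_ae (hae.and h))
    have hclosed : IsClosed (⋃ j ∈ Finset.range k, closedBall (y j) (c j : ℝ)) :=
      isClosed_biUnion_finset fun j _ => isClosed_closedBall
    have htF : t ∈ ball u v ∩ (⋃ j ∈ Finset.range k, closedBall (y j) (c j : ℝ))ᶜ := by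
      refine ⟨htb, fun hF => ?_⟩
      simp only [Set.mem_iUnion] at hF
      obtain ⟨j, -, hj⟩ := hF
      exact htW (Set.mem_iUnion.2 ⟨j, hj⟩)
    obtain ⟨η, hη, hball⟩ := Metric.isOpen_iff.1 (isOpen_ball.inter hclosed.isOpen_compl) t htF
    have hlim0 : Tendsto (fun ρ : ℝ => ρ + K * ρ ^ s) (𝓝[>] 0) (𝓝 0) := by
      have := tendsto_id.add ((Real.continuousAt_rpow_const 0 s (Or.inr hs0.le)).tendsto.const_mul K)
      rw [Real.zero_rpow hs0.ne', mul_zero, add_zero] at this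
      exact this.mono_left nhdsWithin_le_nhds
    have hk : (0 : ℝ) < 1 / (k + 1) := by positivity
    obtain ⟨δ, hδ, hsub⟩ := mem_nhdsGT_iff_exists_Ioo_subset.1
      ((hgood htW).and ((hlim0.eventually (gt_mem_nhds hη)).and (Ioo_mem_nhdsGT hk)))
    obtain ⟨i, hi, hti⟩ := hlim δ hδ
    obtain ⟨h1, h2, h3⟩ := hsub ⟨hr i, hi⟩
    have h2 : r i + K * r i ^ s < η := h2
    have hsubball : closedBall (x i) (r i) ⊆ ball t η := fun z hz => by
      rw [mem_closedBall] at hz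
      rw [mem_ball]
      have h4 : dist (x i) t ≤ K * r i ^ s := by rwa [dist_comm, Real.dist_eq]
      linarith [dist_triangle z (x i) t]
    refine ⟨⟨(x i, r i), h1 _ hti⟩, ⟨i, rfl, h3.2⟩, fun z hz => ?_, fun j hj => ?_⟩
    · exact ball_subset_closedBall (hball (hsubball hz)).1
    · exact Set.disjoint_left.2 fun z hz hzj => (hball (hsubball hz)).2
        (Set.mem_biUnion (Finset.mem_coe.2 (Finset.mem_range.2 hj)) hzj)
  choose f hf1 hf2 hf3 using step
  let B : ℕ → {b : ℝ × ℝ // volume (ball b.1 b.2 \ W) ≠ 0} :=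
    fun n => Nat.rec ⟨(a, R), ha⟩ (fun n b => f b n) n
  obtain ⟨t, ht⟩ := IsCompact.nonempty_iInter_of_sequence_nonempty_isCompact_isClosed
    (fun n => closedBall (B n).1.1 (B n).1.2) (fun n => hf2 (B n) n)
    (fun n => ((nonempty_of_measure_ne_zero (B n).2).mono Set.sdiff_subset).mono
      ball_subset_closedBall)
    (isCompact_closedBall _ _) (fun n => isClosed_closedBall)
  rw [Set.mem_iInter] at ht
  refine ⟨t, ht 0, fun ε hε => ?_, fun hW' => ?_⟩
  · obtain ⟨n, hn⟩ := exists_nat_one_div_lt hε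
    obtain ⟨i, hi, hi'⟩ := hf1 (B n) n
    refine ⟨i, hi'.trans hn, ?_⟩
    have h1 : t ∈ closedBall (f (B n) n).1.1 (f (B n) n).1.2 := ht (n + 1)
    rw [hi] at h1
    exact h1
  · obtain ⟨j, hj⟩ := Set.mem_iUnion.1 hW'
    exact Set.disjoint_left.1 (hf3 (B (j + 1)) (j + 1) j j.lt_succ_self) (ht (j + 2)) hj

/-- **Mass transference** on the real line: if the enlarged balls `closedBall (x i) (K * r i ^ s)`
have a limsup set of full Lebesgue measure, then the limsup set of the balls
`closedBall (x i) (r i)` has infinite `s`-dimensional Hausdorff measure in every ball. -/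
theorem hausdorffMeasure_limsup_closedBall_inter (hr : ∀ i, 0 < r i) (hs0 : 0 < s) (hs1 : s < 1)
    (hK : 1 ≤ K) (h : ∀ᵐ t : ℝ, ∀ ε > 0, ∃ i, r i < ε ∧ |t - x i| ≤ K * r i ^ s)
    {a R : ℝ} (hR : 0 < R) :
    μH[s] ({t | ∀ ε > 0, ∃ i, r i < ε ∧ |t - x i| ≤ r i} ∩ closedBall a R) = ∞ := by
  by_contra hM
  set E : Set ℝ := {t | ∀ ε > 0, ∃ i, r i < ε ∧ |t - x i| ≤ r i} ∩ closedBall a R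
  set M : ℝ≥0∞ := μH[s] E + 1
  have hMtop : M ≠ ∞ := ENNReal.add_ne_top.2 ⟨hM, ENNReal.one_ne_top⟩
  obtain ⟨δ, hδM, hδ0, hδ1⟩ : ∃ δ : ℝ, 2 * δ ^ (1 - s) * M.toReal < 2 * R ∧ 0 < δ ∧ δ < 1 := by
    have h1 : Tendsto (fun δ : ℝ => 2 * δ ^ (1 - s) * M.toReal) (𝓝[>] 0) (𝓝 0) := by
      have := ((Real.continuousAt_rpow_const 0 (1 - s)
        (Or.inr (by linarith))).tendsto.const_mul 2).mul_const M.toReal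
      rw [Real.zero_rpow (by linarith), mul_zero, zero_mul] at this
      exact this.mono_left nhdsWithin_le_nhds
    exact ((h1.eventually (gt_mem_nhds (by positivity : 0 < 2 * R))).and
      (Ioo_mem_nhdsGT one_pos)).exists
  have hlt : (⨅ (T : ℕ → Set ℝ) (_ : E ⊆ ⋃ n, T n) (_ : ∀ n, ediam (T n) ≤ ENNReal.ofReal δ),
      ∑' n, ⨆ _ : (T n).Nonempty, ediam (T n) ^ s) < M := by
    refine lt_of_le_of_lt ?_ (ENNReal.lt_add_right hM one_ne_zero)
    rw [Measure.hausdorffMeasure_apply]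
    exact le_iSup₂_of_le (ENNReal.ofReal δ) (ENNReal.ofReal_pos.2 hδ0) le_rfl
  simp only [iInf_lt_iff] at hlt
  obtain ⟨T, hcov, hdiam, hsum⟩ := hlt
  have hdiam_top : ∀ n, ediam (T n) ≠ ∞ := fun n => ne_top_of_le_ne_top ENNReal.ofReal_ne_top (hdiam n)
  set c : ℕ → ℝ≥0 := fun n => (ediam (T n)).toNNReal
  have hc : ∀ n, (c n : ℝ≥0∞) = ediam (T n) := fun n => ENNReal.coe_toNNReal (hdiam_top n)
  have hcδ : ∀ n, (c n : ℝ) ≤ δ := fun n => by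
    have := hdiam n
    rw [← hc, ← ENNReal.ofReal_coe_nnreal] at this
    exact (ENNReal.ofReal_le_ofReal_iff hδ0.le).1 this
  have hcs : ∑' n, (c n : ℝ≥0∞) ^ s < M := by
    refine lt_of_le_of_lt (ENNReal.tsum_le_tsum fun n => ?_) hsum
    rw [hc]
    rcases (T n).eq_empty_or_nonempty with he | hne
    · simp [he, hs0]
    · simp [hne]
  have hex : ∀ n, ∃ y : ℝ, T n ⊆ closedBall y (c n) := fun n => by
    rcases (T n).eq_empty_or_nonempty with he | ⟨y, hy⟩
    · exact ⟨0, by simp [he]⟩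
    · refine ⟨y, fun z hz => ?_⟩
      rw [mem_closedBall, dist_nndist, NNReal.coe_le_coe, ← ENNReal.coe_le_coe, ← edist_nndist, hc]
      exact edist_le_ediam_of_mem hz hy
  choose y hy using hex
  have hvol : volume (⋃ i, closedBall (y i) (c i)) < volume (ball a R) := by
    have hterm : ∀ i, volume (closedBall (y i) (c i)) ≤
        ENNReal.ofReal (2 * δ ^ (1 - s)) * (c i : ℝ≥0∞) ^ s := fun i => by
      rw [Real.volume_closedBall, ← ENNReal.ofReal_coe_nnreal,
        ENNReal.ofReal_rpow_of_nonneg (c i).coe_nonneg hs0.le, ← ENNReal.ofReal_mul (by positivity),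
        mul_assoc]
      have := Real.min_le_rpow_mul_rpow hδ0 (c i).coe_nonneg hs0 hs1
      rw [min_eq_right (hcδ i)] at this
      gcongr
    calc volume (⋃ i, closedBall (y i) (c i)) ≤ ∑' i, volume (closedBall (y i) (c i : ℝ)) :=
          measure_iUnion_le _
      _ ≤ ENNReal.ofReal (2 * δ ^ (1 - s)) * ∑' i, (c i : ℝ≥0∞) ^ s := by
          rw [← ENNReal.tsum_mul_left]
          exact ENNReal.tsum_le_tsum hterm
      _ ≤ ENNReal.ofReal (2 * δ ^ (1 - s)) * M := by gcongr
      _ = ENNReal.ofReal (2 * δ ^ (1 - s) * M.toReal) := by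
          rw [ENNReal.ofReal_mul (q := M.toReal) (by positivity), ENNReal.ofReal_toReal hMtop]
      _ < volume (ball a R) := by
          rw [Real.volume_ball]
          exact (ENNReal.ofReal_lt_ofReal_iff (by positivity)).2 hδM
  have hne : volume (ball a R \ ⋃ i, closedBall (y i) (c i)) ≠ 0 := fun h0 =>
    not_le.2 hvol (by
      simpa [h0] using measure_le_inter_add_sdiff volume (ball a R)
        (⋃ i, closedBall (y i) (c i)) |>.trans (add_le_add_left (measure_mono Set.inter_subset_right) _))
  obtain ⟨t, ht1, ht2, ht3⟩ := exists_mem_limsup_closedBall_notMem hr hs0 hs1 hK h y c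
    (fun i => by exact_mod_cast (hcδ i).trans hδ1.le) (hcs.trans_le le_top).ne hne
  obtain ⟨n, hn⟩ := Set.mem_iUnion.1 (hcov ⟨ht2, ht1⟩)
  exact ht3 (Set.mem_iUnion.2 ⟨n, hy n hn⟩)

end LimsupBalls

end MassTransference

/-- For `μ > 2` and `Q ≥ 1`, `H^{2/μ}(A_{μ,Q}) = ∞`; in particular
`dim_H(A_{μ,Q}) ≥ 2/μ`. -/
theorem hausdorff_measure_AsetQ (μ : ℝ) (Q : ℕ) (hμ : 2 < μ) (hQ : 1 ≤ Q) :
    μH[(2 / μ : ℝ)] (AsetQ μ Q) = ⊤ ∧ ENNReal.ofReal (2 / μ) ≤ dimH (AsetQ μ Q) := by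
  have hs0 : 0 < 2 / μ := by positivity
  have hs1 : 2 / μ < 1 := (div_lt_one (by linarith)).2 hμ
  have hμ0 : 0 < μ := by linarith
  have key : μH[(2 / μ : ℝ)] (AsetQ μ Q) = ⊤ := by
    set N : ℕ := 4 * Q with hN
    have hN0 : 0 < N := by positivity
    let ι := {pq : ℤ × ℕ // 0 < pq.2 ∧ N ∣ pq.2 ∧ IsCoprime pq.1 (pq.2 : ℤ)}
    let x : ι → ℝ := fun i => (i.1.1 : ℝ) / (i.1.2 : ℝ)
    let r : ι → ℝ := fun i => (i.1.2 : ℝ) ^ (-μ)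
    have hq : ∀ i : ι, (0 : ℝ) < i.1.2 := fun i => by exact_mod_cast i.2.1
    have hr : ∀ i, 0 < r i := fun i => Real.rpow_pos_of_pos (hq i) _
    have hrs : ∀ i, r i ^ (2 / μ) = 1 / (i.1.2 : ℝ) ^ 2 := fun i => by
      have : -μ * (2 / μ) = -(2 : ℕ) := by push_cast; field_simp
      rw [← Real.rpow_mul (hq i).le, this, Real.rpow_neg (hq i).le, Real.rpow_natCast, one_div]
    have hK : (1 : ℝ) ≤ 2 * N * (N + 1) ^ 2 := by
      have : (1 : ℝ) ≤ N := by exact_mod_cast hN0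
      nlinarith [sq_nonneg (N : ℝ)]
    have hae : ∀ᵐ t : ℝ, ∀ ε > 0, ∃ i, r i < ε ∧
        |t - x i| ≤ 2 * N * (N + 1) ^ 2 * r i ^ (2 / μ) := by
      filter_upwards [(Set.countable_range ((↑) : ℚ → ℝ)).ae_notMem volume] with t ht ε hε
      have hlim : ∀ᶠ n : ℕ in Filter.atTop, (n : ℝ) ^ (-μ) < ε :=
        ((tendsto_rpow_neg_atTop hμ0).comp tendsto_natCast_atTop_atTop).eventually
          (gt_mem_nhds hε)
      obtain ⟨K, hKε⟩ := Filter.eventually_atTop.1 hlim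
      obtain ⟨p, q, hKq, hq0, hNq, hpq, hle⟩ :=
        Irrational.exists_coprime_dvd_abs_sub_le (t := t) ht hN0 K
      refine ⟨⟨(p, q), hq0, hNq, hpq⟩, hKε q hKq, ?_⟩
      rw [hrs, mul_one_div]
      exact hle
    have htop := hausdorffMeasure_limsup_closedBall_inter hr hs0 hs1 hK hae
      (a := 1 / 2) (R := 1 / 2) (by norm_num)
    have hsub : {t | ∀ ε > 0, ∃ i, r i < ε ∧ |t - x i| ≤ r i} ∩ Metric.closedBall (1 / 2) (1 / 2) ⊆
        AsetQ μ Q ∪ Set.range ((↑) : ℚ → ℝ) := by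
      rintro t ⟨ht, htI⟩
      by_cases hirr : t ∈ Set.range ((↑) : ℚ → ℝ)
      · exact Or.inr hirr
      refine Or.inl ⟨?_, hirr, fun hfin => ?_⟩
      · rw [Real.closedBall_eq_Icc] at htI
        norm_num at htI
        exact htI
      · have hmem : ∀ i : ι, |t - x i| ≤ r i → i.1 ∈ {pq : ℤ × ℕ | 0 < pq.2 ∧ 4 * Q ∣ pq.2 ∧
            IsCoprime pq.1 (pq.2 : ℤ) ∧ |t - (pq.1 : ℝ) / (pq.2 : ℝ)| ≤ (pq.2 : ℝ) ^ (-μ)} :=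
          fun i hi => ⟨i.2.1, i.2.2.1, i.2.2.2, hi⟩
        obtain ⟨i, -, hi⟩ := ht 1 one_pos
        obtain ⟨b, hb, hmin⟩ := Set.exists_min_image _
          (fun pq : ℤ × ℕ => (pq.2 : ℝ) ^ (-μ)) hfin ⟨i.1, hmem i hi⟩
        obtain ⟨j, hj, hj'⟩ := ht ((b.2 : ℝ) ^ (-μ))
          (Real.rpow_pos_of_pos (by exact_mod_cast hb.1) _)
        exact absurd hj (not_lt.2 (hmin j.1 (hmem j hj')))
    have := Measure.nullSingletonClass_hausdorff ℝ hs0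
    have hQ0 : μH[(2 / μ : ℝ)] (Set.range ((↑) : ℚ → ℝ)) = 0 :=
      (Set.countable_range _).measure_zero _
    have hle := (measure_mono hsub).trans (measure_union_le (μ := μH[(2 / μ : ℝ)]) _ _)
    rw [htop, hQ0, add_zero] at hle
    exact top_le_iff.1 hle
  refine ⟨key, ?_⟩
  have : ((2 / μ).toNNReal : ℝ) = 2 / μ := Real.coe_toNNReal _ hs0.le
  exact le_dimH_of_hausdorffMeasure_eq_top (d := (2 / μ).toNNReal) (by rwa [this])
end
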